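/- Let Γ be an M-metrised graph (M a sharp, integral commutative monoid), and let G be the underlying combinatorial graph. Then there is a subdivision H of G such that dgon(Γ) ≥ dgon(H), where dgon(H) denotes the divisorial gonality of H regarded as an ℕ-metrised graph in which every edge has length 1. -/

import Mathlib

noncomputable section
open scoped Classical

/-! ### Groupification of a cancellative additive commutative monoid -/

variable (M : Type) [AddCancelCommMonoid M]

def gpSetoid : Setoid (M × M) where
  r p q := p.1 + q.2 = q.1 + p.2
  iseqv := by
    refine ⟨fun p => rfl, fun h => h.symm, fun {p q r} h1 h2 => ?_⟩
    have key : (p.1 + r.2) + (q.1 + q.2) = (r.1 + p.2) + (q.1 + q.2) := by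
      calc (p.1 + r.2) + (q.1 + q.2) = (p.1 + q.2) + (q.1 + r.2) := by abel
        _ = (q.1 + p.2) + (r.1 + q.2) := by rw [h1, h2]
        _ = (r.1 + p.2) + (q.1 + q.2) := by abel
    exact add_right_cancel key

/-- The groupification `M^gp` of a cancellative commutative monoid `M`:
the quotient of `M × M` by `(a,b) ~ (c,d) ↔ a + d = c + b` (think of `(a,b)` as `a - b`). -/
def Gp : Type := Quotient (gpSetoid M)

namespace Gp

variable {M}

/-- The element `a - b` of `M^gp`. -/
def mk (a b : M) : Gp M := Quotient.mk (gpSetoid M) (a, b)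

instance : Zero (Gp M) := ⟨mk 0 0⟩

instance : Add (Gp M) :=
  ⟨Quotient.map₂ (fun p q => (p.1 + q.1, p.2 + q.2)) (by
    intro p p' hp q q' hq
    show (p.1 + q.1) + (p'.2 + q'.2) = (p'.1 + q'.1) + (p.2 + q.2)
    calc (p.1 + q.1) + (p'.2 + q'.2) = (p.1 + p'.2) + (q.1 + q'.2) := by abel
      _ = (p'.1 + p.2) + (q'.1 + q.2) := by rw [hp, hq]
      _ = (p'.1 + q'.1) + (p.2 + q.2) := by abel)⟩

instance : Neg (Gp M) :=
  ⟨Quotient.map (fun p => (p.2, p.1)) (by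
    intro p p' hp
    show p.2 + p'.1 = p'.2 + p.1
    calc p.2 + p'.1 = p'.1 + p.2 := by abel
      _ = p.1 + p'.2 := hp.symm
      _ = p'.2 + p.1 := by abel)⟩

lemma mk_add_mk (a b c d : M) : mk a b + mk c d = mk (a + c) (b + d) := rfl
lemma neg_mk (a b : M) : -(mk a b) = mk b a := rfl
lemma zero_def : (0 : Gp M) = mk 0 0 := rfl

instance : AddCommGroup (Gp M) where
  add := (· + ·)
  zero := 0
  neg := Neg.neg
  nsmul := nsmulRec
  zsmul := zsmulRec
  add_assoc := by
    intro a b c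
    induction a using Quotient.inductionOn with | h a =>
    induction b using Quotient.inductionOn with | h b =>
    induction c using Quotient.inductionOn with | h c =>
    exact Quotient.sound (by
      show ((a.1 + b.1) + c.1) + (a.2 + (b.2 + c.2)) = (a.1 + (b.1 + c.1)) + ((a.2 + b.2) + c.2)
      abel)
  zero_add := by
    intro a
    induction a using Quotient.inductionOn with | h a =>
    exact Quotient.sound (by
      show (0 + a.1) + a.2 = a.1 + (0 + a.2)
      abel)
  add_zero := by
    intro a
    induction a using Quotient.inductionOn with | h a =>
    exact Quotient.sound (by
      show (a.1 + 0) + a.2 = a.1 + (a.2 + 0)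
      abel)
  neg_add_cancel := by
    intro a
    induction a using Quotient.inductionOn with | h a =>
    exact Quotient.sound (by
      show (a.2 + a.1) + 0 = 0 + (a.1 + a.2)
      abel)
  add_comm := by
    intro a b
    induction a using Quotient.inductionOn with | h a =>
    induction b using Quotient.inductionOn with | h b =>
    exact Quotient.sound (by
      show (a.1 + b.1) + (b.2 + a.2) = (b.1 + a.1) + (a.2 + b.2)
      abel)

/-- The canonical map `M → M^gp`. -/
def of : M →+ Gp M where
  toFun a := mk a 0
  map_zero' := rfl
  map_add' := by
    intro a b
    exact (Quotient.sound (by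
      show (a + b) + (0 + 0) = (a + b) + 0
      abel) : mk (a + b) 0 = mk (a + b) (0 + 0))

/-- Functoriality of groupification: a monoid homomorphism `f : M →+ N` induces
`f^gp : M^gp →+ N^gp`. -/
def map {N : Type} [AddCancelCommMonoid N] (f : M →+ N) : Gp M →+ Gp N where
  toFun := Quotient.map (fun p => (f p.1, f p.2)) (by
    intro p p' hp
    show f p.1 + f p'.2 = f p'.1 + f p.2
    rw [← f.map_add, ← f.map_add, hp])
  map_zero' := by
    show mk (f 0) (f 0) = mk 0 0
    rw [f.map_zero]
  map_add' := by
    intro a b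
    induction a using Quotient.inductionOn with | h a =>
    induction b using Quotient.inductionOn with | h b =>
    show mk (f (a.1 + b.1)) (f (a.2 + b.2)) = mk (f a.1 + f b.1) (f a.2 + f b.2)
    rw [f.map_add, f.map_add]

end Gp

/-- Sharpness: the only invertible element of `M` is `0`. -/
def Sharp : Prop := ∀ a b : M, a + b = 0 → a = 0

/-! ### Monoid-metrised graphs -/

/-- A graph (Definition 2.3 of the paper) together with a metric taking values in the
monoid `M`: `X` is the finite set of vertices and half-edges, `r` sends an element to its
root vertex, `i` is the pairing involution on half-edges, and `l` assigns a length in `M`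
to every half-edge (and `0` to every vertex). -/
structure MGraph where
  X : Type
  [finX : Fintype X]
  r : X → X
  i : X → X
  r_idem : ∀ x, r (r x) = r x
  i_invol : ∀ x, i (i x) = x
  fix_iff : ∀ x, i x = x ↔ r x = x
  l : X → M
  l_i : ∀ x, l (i x) = l x
  l_zero_iff : ∀ x, l x = 0 ↔ i x = x

attribute [instance] MGraph.finX

namespace MGraph

variable {M} (G : MGraph M)

/-- `x` is a vertex iff it is fixed by the involution. -/
def IsVertex (x : G.X) : Prop := G.i x = x

/-- `x` is a half-edge iff it is not fixed by the involution. -/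
def IsHalfEdge (x : G.X) : Prop := G.i x ≠ x

/-- The vertex set of `G`. -/
abbrev V : Type := { x : G.X // G.IsVertex x }

/-- The root of any element of `X` is a vertex. -/
def rv (x : G.X) : G.V := ⟨G.r x, (G.fix_iff (G.r x)).mpr (G.r_idem x)⟩

/-- Two vertices are adjacent if some edge joins them. -/
def Adj (u v : G.V) : Prop := ∃ x, G.IsHalfEdge x ∧ G.rv x = u ∧ G.rv (G.i x) = v

/-- `G` is connected. (All graphs in the paper are assumed connected.) -/
def IsConnected : Prop := Nonempty G.X ∧ ∀ u v : G.V, Relation.ReflTransGen G.Adj u v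

/-- The degree of a divisor `D : V → ℤ`. -/
def degD (D : G.V → ℤ) : ℤ := ∑ v, D v

/-- A divisor is effective if all its coefficients are nonnegative. -/
def Effective (D : G.V → ℤ) : Prop := ∀ v, 0 ≤ D v

/-- `g : V → M^gp` is piecewise linear if, along every half-edge, the difference of the
values of `g` at the two endpoints is an integer multiple of the length of that edge. -/
def IsPL (g : G.V → Gp M) : Prop :=
  ∀ x, G.IsHalfEdge x → ∃ n : ℤ, g (G.rv x) - g (G.rv (G.i x)) = n • Gp.of (G.l x)

/-- The (outgoing) integer slope of `g` along the half-edge `x`. -/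
def slope (g : G.V → Gp M) (x : G.X) : ℤ :=
  if h : ∃ n : ℤ, g (G.rv x) - g (G.rv (G.i x)) = n • Gp.of (G.l x) then h.choose else 0

/-- The Laplacian of a piecewise linear function. -/
def lap (g : G.V → Gp M) : G.V → ℤ :=
  fun v => ∑ x : G.X, if G.IsHalfEdge x ∧ G.r x = v.val then G.slope g x else 0

/-- Principal divisors: those of the form `Δ(g)` for a piecewise linear `g`. -/
def IsPrincipal (D : G.V → ℤ) : Prop := ∃ g, G.IsPL g ∧ G.lap g = D

/-- The rank of a divisor `D`:
`r(D) = max { k : for every effective divisor F of degree k, |D - F| ≠ ∅ }`. -/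
def rank (D : G.V → ℤ) : ℤ :=
  sSup {k : ℤ | ∀ F : G.V → ℤ, G.Effective F → G.degD F = k →
    ∃ E : G.V → ℤ, G.Effective E ∧ G.IsPrincipal (D - F - E)}

/-- The divisorial gonality: the minimal degree of a divisor of rank at least 1. -/
def dgon : ℤ := sInf {d : ℤ | ∃ D : G.V → ℤ, 1 ≤ G.rank D ∧ G.degD D = d}

end MGraph


/-! ### Unit subdivision of an `ℕ`-metrised graph

Given an `ℕ`-metrised graph `Γ`, the graph `Subdiv Γ` is the subdivision of the
underlying graph of `Γ` in which every edge `{e, i e}` is subdivided exactly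
`l e - 1` times (so an edge of length `k` becomes a path of `k` edges), regarded as an
`ℕ`-metrised graph in which every edge has length `1`. -/

namespace MGraph

variable (G : MGraph ℕ)

/-- An arbitrary enumeration of `X`, used only to pick a canonical half-edge inside each
edge of `G`. -/
def ordx : G.X → ℕ := fun x => ((Fintype.equivFin G.X) x : ℕ)

/-- Interior vertices of the subdivision: the vertex at distance `j` from `r e` on the
path replacing the edge `{e, i e}` (where `0 < j < l e`), recorded on the canonical
half-edge of the edge. -/
def IntVert : Type :=
  {p : G.X × ℕ // G.IsHalfEdge p.1 ∧ 0 < p.2 ∧ p.2 < G.l p.1 ∧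
    ordx G p.1 ≤ ordx G (G.i p.1)}

/-- Half-edges of the subdivision: the half-edge of the `j`-th unit segment (counted from
`r e`) of the path replacing the edge `{e, i e}`, rooted at the endpoint at distance `j`
from `r e` (where `0 ≤ j < l e`). -/
def SubH : Type := {p : G.X × ℕ // G.IsHalfEdge p.1 ∧ p.2 < G.l p.1}

instance : Finite (IntVert G) :=
  Finite.of_injective
    (fun p => ((p.val.1, ⟨p.val.2, by
      have h2 := p.property.2.2.1
      have hle : G.l p.val.1 ≤ Finset.univ.sup G.l := Finset.le_sup (Finset.mem_univ _)
      omega⟩) : G.X × Fin (Finset.univ.sup G.l + 1)))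
    (by
      intro p q h
      apply Subtype.ext
      have h1 := congrArg Prod.fst h
      have h2 := congrArg (fun z => (z.2 : ℕ)) h
      exact Prod.ext h1 h2)

instance : Finite (SubH G) :=
  Finite.of_injective
    (fun p => ((p.val.1, ⟨p.val.2, by
      have h2 := p.property.2
      have hle : G.l p.val.1 ≤ Finset.univ.sup G.l := Finset.le_sup (Finset.mem_univ _)
      omega⟩) : G.X × Fin (Finset.univ.sup G.l + 1)))
    (by
      intro p q h
      apply Subtype.ext
      have h1 := congrArg Prod.fst h
      have h2 := congrArg (fun z => (z.2 : ℕ)) h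
      exact Prod.ext h1 h2)

/-- Vertices of the subdivision: old vertices plus interior vertices. -/
abbrev SubV : Type := G.V ⊕ IntVert G

/-- The canonical presentation of the interior vertex at distance `j` from `r e` along
the path replacing the edge `{e, i e}` (so also at distance `l e - j` from `r (i e)`). -/
def ivtx (e : G.X) (he : G.IsHalfEdge e) (j : ℕ) (hj : 0 < j) (hj' : j < G.l e) :
    IntVert G :=
  if h : ordx G e ≤ ordx G (G.i e) then ⟨(e, j), he, hj, hj', h⟩
  else
    ⟨(G.i e, G.l e - j), by
      refine ⟨?_, by omega, ?_, ?_⟩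
      · show G.i (G.i e) ≠ G.i e
        rw [G.i_invol]
        exact fun hx => he hx.symm
      · show G.l e - j < G.l (G.i e)
        rw [G.l_i]
        omega
      · show ordx G (G.i e) ≤ ordx G (G.i (G.i e))
        rw [G.i_invol]
        omega⟩

/-- The root map of the subdivision. -/
def subR : SubV G ⊕ SubH G → SubV G ⊕ SubH G
  | .inl v => .inl v
  | .inr p =>
      if h : p.val.2 = 0 then .inl (.inl (G.rv p.val.1))
      else .inl (.inr (ivtx G p.val.1 p.property.1 p.val.2 (Nat.pos_of_ne_zero h)
        p.property.2))

/-- The involution of the subdivision: the `j`-th segment of `e`, seen from its other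
endpoint, is the `(l e - 1 - j)`-th segment of `i e`. -/
def subI : SubV G ⊕ SubH G → SubV G ⊕ SubH G
  | .inl v => .inl v
  | .inr p =>
      .inr ⟨(G.i p.val.1, G.l p.val.1 - 1 - p.val.2), by
        have h1 : p.val.2 < G.l p.val.1 := p.property.2
        refine ⟨?_, ?_⟩
        · show G.i (G.i p.val.1) ≠ G.i p.val.1
          rw [G.i_invol]
          exact fun hx => p.property.1 hx.symm
        · show G.l p.val.1 - 1 - p.val.2 < G.l (G.i p.val.1)
          rw [G.l_i]
          have h0 : G.l p.val.1 ≠ 0 :=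
            fun h => p.property.1 ((G.l_zero_iff p.val.1).mp h)
          omega⟩

/-- The length function of the subdivision: every edge has length `1`. -/
def subL : SubV G ⊕ SubH G → ℕ
  | .inl _ => 0
  | .inr _ => 1

lemma subI_ne (p : SubH G) : subI G (Sum.inr p) ≠ Sum.inr p := by
  intro h
  apply p.property.1
  have h' := congrArg Subtype.val (Sum.inr.inj h)
  exact congrArg Prod.fst h'

/-- The subdivision of (the underlying graph of) the `ℕ`-metrised graph `G` in which
every edge `{e, i e}` is subdivided exactly `l e - 1` times, regarded as an `ℕ`-metrised
graph in which every edge has length `1`. -/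
noncomputable def Subdiv : MGraph ℕ where
  X := SubV G ⊕ SubH G
  finX := Fintype.ofFinite _
  r := subR G
  i := subI G
  r_idem := by
    rintro (v | p)
    · rfl
    · by_cases h : p.val.2 = 0 <;> simp [subR, h]
  i_invol := by
    rintro (v | p)
    · rfl
    · apply congrArg Sum.inr
      apply Subtype.ext
      have h1 : p.val.2 < G.l p.val.1 := p.property.2
      have h0 : G.l p.val.1 ≠ 0 := fun h => p.property.1 ((G.l_zero_iff p.val.1).mp h)
      simp only [subI]
      refine Prod.ext (G.i_invol p.val.1) ?_
      show G.l (G.i p.val.1) - 1 - (G.l p.val.1 - 1 - p.val.2) = p.val.2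
      rw [G.l_i]
      omega
  fix_iff := by
    rintro (v | p)
    · simp [subI, subR]
    · constructor
      · intro h
        exact absurd h (subI_ne G p)
      · intro h
        exfalso
        by_cases h0 : p.val.2 = 0 <;> simp [subR, h0] at h
  l := subL G
  l_i := by rintro (v | p) <;> rfl
  l_zero_iff := by
    rintro (v | p)
    · simp [subL, subI]
    · simp only [subL]
      constructor
      · intro h
        exact absurd h one_ne_zero
      · intro h
        exact absurd h (subI_ne G p)

/-- The same underlying graph as `G`, re-equipped with the `ℕ`-valued metric `l₂`. -/
def reMetrize {M : Type} [AddCancelCommMonoid M] (G : MGraph M) (l₂ : G.X → ℕ)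
    (h1 : ∀ x, l₂ (G.i x) = l₂ x) (h2 : ∀ x, l₂ x = 0 ↔ G.i x = x) : MGraph ℕ where
  X := G.X
  finX := G.finX
  r := G.r
  i := G.i
  r_idem := G.r_idem
  i_invol := G.i_invol
  fix_iff := G.fix_iff
  l := l₂
  l_i := h1
  l_zero_iff := h2

end MGraph

section Gordan

/-- **Gordan's theorem**: finitely many linear functionals are simultaneously positive somewhere
as soon as they satisfy no nontrivial linear relation with nonnegative coefficients. -/
theorem exists_forall_pos_of_no_nonneg_relation {W : Type*} [AddCommGroup W] [Module ℚ W] (n : ℕ) :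
    ∀ a : Fin n → W →ₗ[ℚ] ℚ,
      (∀ u : Fin n → ℚ, (∀ k, 0 ≤ u k) → (∑ k, u k • a k = 0) → ∀ k, u k = 0) →
      ∃ w, ∀ k, 0 < a k w := by
  induction n with
  | zero => exact fun a _ => ⟨0, fun k => k.elim0⟩
  | succ n ih =>
    intro a ha
    have ha0 : a 0 ≠ 0 := by
      intro h0
      have := ha (Pi.single 0 1) (fun k => by
        by_cases h : k = 0
        · subst h; simp
        · simp [h]) (by
        rw [Finset.sum_eq_single 0] <;> simp +contextual [h0]) 0
      simp at this
    obtain ⟨z, hz⟩ : ∃ z, a 0 z = 1 := by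
      obtain ⟨z, hz⟩ : ∃ z, a 0 z ≠ 0 := by
        by_contra! h
        exact ha0 (LinearMap.ext h)
      exact ⟨(a 0 z)⁻¹ • z, by simp [hz]⟩
    have key : ∀ w, 0 ≤ a 0 w → (∀ k : Fin n, 0 < a k.succ w) → ∃ w, ∀ k, 0 < a k w := by
      intro w hw0 hw
      have : ∀ s : Finset (Fin n), ∃ ε : ℚ, 0 < ε ∧ ∀ k ∈ s, 0 < a k.succ (w + ε • z) := by
        intro s
        induction s using Finset.induction_on with
        | empty => exact ⟨1, one_pos, by simp⟩
        | insert k s _ hs =>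
          obtain ⟨ε, hε, h⟩ := hs
          have hk := hw k
          refine ⟨min ε (a k.succ w / (|a k.succ z| + 1)), lt_min hε (by positivity), ?_⟩
          intro j hj
          set δ := min ε (a k.succ w / (|a k.succ z| + 1)) with hδ
          have hδ0 : 0 < δ := lt_min hε (by positivity)
          have hδ1 : δ ≤ ε := min_le_left _ _
          have hδ2 : δ ≤ a k.succ w / (|a k.succ z| + 1) := min_le_right _ _
          simp only [map_add, map_smul, smul_eq_mul] at h ⊢
          rcases Finset.mem_insert.1 hj with rfl | hj
          · rw [le_div_iff₀ (by positivity)] at hδ2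
            have h1 : δ * (- |a j.succ z|) ≤ δ * a j.succ z :=
              mul_le_mul_of_nonneg_left (neg_abs_le _) hδ0.le
            nlinarith
          · have h1 := h j hj
            have h2 := hw j
            rcases le_total 0 (a j.succ z) with h3 | h3
            · have := mul_nonneg hδ0.le h3
              linarith
            · have := mul_le_mul_of_nonpos_right hδ1 h3
              linarith
      obtain ⟨ε, hε, h⟩ := this Finset.univ
      refine ⟨w + ε • z, fun k => ?_⟩
      induction k using Fin.cases with
      | zero => simp only [map_add, map_smul, smul_eq_mul, hz]; linarith
      | succ k => exact h k (Finset.mem_univ _)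
    obtain ⟨w, hw⟩ := ih (fun k => a k.succ) (fun u hu hsum k => by
      have := ha (Fin.cons 0 u) (fun k => by
        induction k using Fin.cases with
        | zero => simp
        | succ k => simpa using hu k) (by
        rw [Fin.sum_univ_succ]
        simpa using hsum) k.succ
      simpa using this)
    rcases le_or_gt 0 (a 0 w) with h0 | h0
    · exact key w h0 hw
    · obtain ⟨c, hc⟩ : ∃ c : ℚ, c = - a 0 w := ⟨_, rfl⟩
      have hcpos : 0 < c := by linarith
      obtain ⟨w', hw'⟩ := ih (fun k => c • a k.succ + a k.succ w • a 0) (fun u hu hsum k => by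
        have := ha (Fin.cons (∑ k, u k * a k.succ w) (fun k => c * u k)) (fun k => by
          induction k using Fin.cases with
          | zero => simpa using Finset.sum_nonneg fun k _ => mul_nonneg (hu k) (hw k).le
          | succ k => simpa using mul_nonneg hcpos.le (hu k)) (by
          rw [Fin.sum_univ_succ, ← hsum]
          simp only [Fin.cons_zero, Fin.cons_succ, smul_add, Finset.sum_add_distrib,
            Finset.sum_smul, smul_smul]
          rw [add_comm]
          simp only [mul_comm]) k.succ
        simpa [hcpos.ne'] using this)
      refine key (c • w' + a 0 w' • w) ?_ fun k => ?_
      · simp only [map_add, map_smul, smul_eq_mul, hc]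
        linarith
      · have := hw' k
        simp only [LinearMap.add_apply, LinearMap.smul_apply, smul_eq_mul] at this
        simp only [map_add, map_smul, smul_eq_mul]
        linarith

/-- A finite family of rationals has a common positive denominator. -/
theorem exists_common_den {ι : Type*} [Finite ι] (q : ι → ℚ) :
    ∃ N : ℕ, 0 < N ∧ ∃ z : ι → ℤ, ∀ k, (N : ℚ) * q k = z k := by
  have := Fintype.ofFinite ι
  refine ⟨∏ k, (q k).den, Finset.prod_pos fun k _ => (q k).den_pos, ?_⟩
  choose c hc using fun k => Finset.dvd_prod_of_mem (fun k => (q k).den) (Finset.mem_univ k)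
  refine ⟨fun k => c k * (q k).num, fun k => ?_⟩
  rw [hc k]
  push_cast
  have := Rat.den_mul_eq_num (q k)
  rw [← this]
  ring

/-- An element of an abelian group on which all homomorphisms to `ℚ` vanish is torsion. -/
theorem exists_nsmul_eq_zero_of_forall_hom {A : Type*} [AddCommGroup A] (x : A)
    (h : ∀ f : A →+ ℚ, f x = 0) : ∃ N : ℕ, 0 < N ∧ N • x = 0 := by
  let ι : A →ₗ[ℤ] TensorProduct ℤ ℚ A := TensorProduct.mk ℤ ℚ A 1
  have hloc : IsLocalizedModule (nonZeroDivisors ℤ) ι :=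
    (isLocalizedModule_iff_isBaseChange (nonZeroDivisors ℤ) ℚ ι).2
      (TensorProduct.isBaseChange ℤ A ℚ)
  have hx : ι x = 0 := by
    rw [← Module.forall_dual_apply_eq_zero_iff ℚ]
    intro φ
    exact h (φ.toAddMonoidHom.comp ι.toAddMonoidHom)
  obtain ⟨⟨m, hm⟩, hmx⟩ := (IsLocalizedModule.eq_zero_iff (nonZeroDivisors ℤ) ι).1 hx
  have hm0 : m ≠ 0 := nonZeroDivisors.ne_zero hm
  refine ⟨m.natAbs, Int.natAbs_pos.2 hm0, ?_⟩
  have hmx' : m • x = 0 := hmx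
  rcases Int.natAbs_eq m with h1 | h1
  · rw [h1, natCast_zsmul] at hmx'
    exact hmx'
  · rw [h1, neg_smul, natCast_zsmul, neg_eq_zero] at hmx'
    exact hmx'

end Gordan

section Sharp

variable {M}

theorem Gp.of_injective : Function.Injective (Gp.of (M := M)) := by
  intro a b h
  have : a + 0 = b + 0 := Quotient.exact h
  simpa using this

theorem Sharp.eq_zero_of_nsmul (hM : Sharp M) {n : ℕ} (hn : 0 < n) {a : M} (h : n • a = 0) :
    a = 0 := by
  obtain ⟨k, rfl⟩ := Nat.exists_eq_succ_of_ne_zero hn.ne'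
  rw [succ_nsmul'] at h
  exact hM _ _ h

theorem Sharp.eq_zero_of_sum (hM : Sharp M) {ι : Type*} {s : Finset ι} {f : ι → M}
    (h : ∑ k ∈ s, f k = 0) {k : ι} (hk : k ∈ s) : f k = 0 := by
  rw [← Finset.add_sum_erase s f hk] at h
  exact hM _ _ h

theorem Sharp.zsmul_of_eq_zero (hM : Sharp M) {n : ℤ} {a : M} (ha : a ≠ 0)
    (h : n • Gp.of a = 0) : n = 0 := by
  by_contra hn
  have h' : n.natAbs • Gp.of a = 0 := by
    rcases Int.natAbs_eq n with h1 | h1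
    · rwa [h1, natCast_zsmul] at h
    · rwa [h1, neg_smul, natCast_zsmul, neg_eq_zero] at h
  rw [← map_nsmul, ← map_zero Gp.of] at h'
  exact ha (hM.eq_zero_of_nsmul (Int.natAbs_pos.2 hn) (Gp.of_injective h'))

/-- A sharp integral monoid admits a homomorphism from its groupification to `ℚ` that is positive
on any prescribed finite family of nonzero elements. -/
theorem Sharp.exists_hom_pos (hM : Sharp M) {ι : Type*} [Finite ι] (t : ι → M)
    (ht : ∀ k, t k ≠ 0) : ∃ ψ : Gp M →+ ℚ, ∀ k, 0 < ψ (Gp.of (t k)) := by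
  obtain ⟨n, ⟨e⟩⟩ := Finite.exists_equiv_fin ι
  let ev : Gp M → (Gp M →+ ℚ) →ₗ[ℚ] ℚ := fun x =>
    { toFun := fun ψ => ψ x
      map_add' := fun _ _ => rfl
      map_smul' := fun _ _ => rfl }
  obtain ⟨ψ, hψ⟩ := exists_forall_pos_of_no_nonneg_relation n
    (fun k => ev (Gp.of (t (e.symm k)))) (by
    intro u hu hsum k
    obtain ⟨N, hN, z, hz⟩ := exists_common_den u
    have hzn : ∀ k, 0 ≤ z k := fun k => by
      have : (0 : ℚ) ≤ z k := by rw [← hz]; exact mul_nonneg (by positivity) (hu k)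
      exact_mod_cast this
    lift z to Fin n → ℕ using hzn
    obtain ⟨K, hK, hK0⟩ := exists_nsmul_eq_zero_of_forall_hom
      (Gp.of (∑ k, z k • t (e.symm k))) (fun f => by
      have h1 := congrArg (fun F => (N : ℚ) * F f) hsum
      simp only [LinearMap.sum_apply, LinearMap.smul_apply, Finset.mul_sum, smul_eq_mul,
        LinearMap.zero_apply, mul_zero] at h1
      rw [← h1]
      simp only [map_sum, map_nsmul]
      refine Finset.sum_congr rfl fun k _ => ?_
      rw [← mul_assoc, hz]
      simp [ev])
    rw [← map_nsmul, ← map_zero Gp.of] at hK0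
    have h2 := hM.eq_zero_of_nsmul hK (Gp.of_injective hK0)
    have h3 := hM.eq_zero_of_sum h2 (Finset.mem_univ k)
    have h4 : z k = 0 := by
      by_contra h
      exact ht _ (hM.eq_zero_of_nsmul (Nat.pos_of_ne_zero h) h3)
    have h5 := hz k
    simp only [h4] at h5
    have : (N : ℚ) ≠ 0 := by exact_mod_cast hN.ne'
    simpa [this] using h5)
  exact ⟨ψ, fun k => by simpa [ev] using hψ (e k)⟩

end Sharp

namespace MGraph

section Rank

variable {M} {G : MGraph M}

theorem isHalfEdge_i {x : G.X} (hx : G.IsHalfEdge x) : G.IsHalfEdge (G.i x) := by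
  intro h
  rw [G.i_invol] at h
  exact hx h.symm

theorem l_ne_zero {x : G.X} (hx : G.IsHalfEdge x) : G.l x ≠ 0 :=
  fun h => hx ((G.l_zero_iff x).1 h)

theorem slope_spec {g : G.V → Gp M} (hg : G.IsPL g) {x : G.X} (hx : G.IsHalfEdge x) :
    g (G.rv x) - g (G.rv (G.i x)) = G.slope g x • Gp.of (G.l x) := by
  have h := hg x hx
  rw [slope, dif_pos h]
  exact h.choose_spec

theorem slope_eq (hM : Sharp M) {g : G.V → Gp M} {x : G.X} (hx : G.IsHalfEdge x) {n : ℤ}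
    (h : g (G.rv x) - g (G.rv (G.i x)) = n • Gp.of (G.l x)) : G.slope g x = n := by
  have hex : ∃ n : ℤ, g (G.rv x) - g (G.rv (G.i x)) = n • Gp.of (G.l x) := ⟨n, h⟩
  have h1 := hex.choose_spec
  rw [slope, dif_pos hex, ← sub_eq_zero]
  refine hM.zsmul_of_eq_zero (l_ne_zero hx) ?_
  rw [sub_zsmul, ← h1, ← h, add_neg_cancel]

theorem slope_i (hM : Sharp M) {g : G.V → Gp M} (hg : G.IsPL g) {x : G.X}
    (hx : G.IsHalfEdge x) : G.slope g (G.i x) = -G.slope g x := by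
  refine slope_eq hM (isHalfEdge_i hx) ?_
  rw [G.i_invol, G.l_i, neg_smul, ← slope_spec hg hx, neg_sub]

theorem lap_eq (g : G.V → Gp M) (v : G.V) :
    G.lap g v = ∑ x : G.X, if G.IsHalfEdge x ∧ G.rv x = v then G.slope g x else 0 := by
  simp only [lap, rv, Subtype.ext_iff]

theorem degD_lap (hM : Sharp M) {g : G.V → Gp M} (hg : G.IsPL g) : G.degD (G.lap g) = 0 := by
  have h1 : G.degD (G.lap g) = ∑ x : G.X, if G.IsHalfEdge x then G.slope g x else 0 := by
    simp only [degD, lap_eq]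
    rw [Finset.sum_comm]
    refine Finset.sum_congr rfl fun x _ => ?_
    by_cases hx : G.IsHalfEdge x <;> simp [hx]
  have h2 : (∑ x : G.X, if G.IsHalfEdge x then G.slope g x else 0)
      = ∑ x : G.X, if G.IsHalfEdge x then -G.slope g x else 0 := by
    rw [← Equiv.sum_comp (Function.Involutive.toPerm G.i G.i_invol)]
    refine Finset.sum_congr rfl fun x _ => ?_
    change (if G.IsHalfEdge (G.i x) then G.slope g (G.i x) else 0) = _
    by_cases hx : G.IsHalfEdge x
    · rw [if_pos (isHalfEdge_i hx), if_pos hx, slope_i hM hg hx]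
    · have hx' : G.i x = x := not_not.1 hx
      rw [hx', if_neg hx, if_neg hx]
  have h3 : (∑ x : G.X, if G.IsHalfEdge x then -G.slope g x else 0)
      = -∑ x : G.X, if G.IsHalfEdge x then G.slope g x else 0 := by
    rw [← Finset.sum_neg_distrib]
    refine Finset.sum_congr rfl fun x _ => ?_
    split_ifs <;> simp
  omega

theorem isPrincipal_zero (hM : Sharp M) : G.IsPrincipal 0 := by
  refine ⟨0, fun x _ => ⟨0, by simp⟩, funext fun v => ?_⟩
  refine Finset.sum_eq_zero fun x _ => ?_
  split_ifs with h
  · exact slope_eq hM h.1 (by simp)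
  · rfl

theorem degD_sub (D E : G.V → ℤ) : G.degD (D - E) = G.degD D - G.degD E := by
  simp [degD, Finset.sum_sub_distrib]

theorem degD_single (v : G.V) (k : ℤ) : G.degD (Pi.single v k) = k := by
  simp [degD]

theorem effective_single (v : G.V) {k : ℤ} (hk : 0 ≤ k) : G.Effective (Pi.single v k) := by
  intro u
  by_cases h : u = v
  · subst h; simpa using hk
  · simp [h]

theorem eq_single_of_degD_eq_one {F : G.V → ℤ} (hF : G.Effective F) (h1 : G.degD F = 1) :
    ∃ v, F = Pi.single v 1 := by
  obtain ⟨v, hv⟩ : ∃ v, F v ≠ 0 := by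
    by_contra! h
    simp [degD, h] at h1
  refine ⟨v, funext fun u => ?_⟩
  rw [degD, ← Finset.add_sum_erase _ _ (Finset.mem_univ v)] at h1
  have h2 : ∀ u ∈ Finset.univ.erase v, 0 ≤ F u := fun u _ => hF u
  have h3 := Finset.sum_nonneg h2
  have h4 := hF v
  have h5 : ∑ u ∈ Finset.univ.erase v, F u = 0 := by omega
  by_cases huv : u = v
  · subst huv
    simp only [Pi.single_eq_same]
    omega
  · rw [Pi.single_eq_of_ne huv]
    exact (Finset.sum_eq_zero_iff_of_nonneg h2).1 h5 u (by simp [huv])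

/-- The set whose supremum defines the rank is bounded by the degree. -/
theorem le_degD_of_forall (hM : Sharp M) (v : G.V) {D : G.V → ℤ} {k : ℤ}
    (h : ∀ F : G.V → ℤ, G.Effective F → G.degD F = k →
      ∃ E : G.V → ℤ, G.Effective E ∧ G.IsPrincipal (D - F - E)) : k ≤ max (G.degD D) 0 := by
  rcases le_or_gt k 0 with hk | hk
  · exact le_max_of_le_right hk
  · obtain ⟨E, hE, g, hg, hgl⟩ := h _ (effective_single v hk.le) (degD_single v k)
    have h1 := degD_lap hM hg
    rw [hgl, degD_sub, degD_sub, degD_single] at h1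
    have h2 : 0 ≤ G.degD E := Finset.sum_nonneg fun u _ => hE u
    exact le_max_of_le_left (by omega)

theorem bddAbove_rank (hM : Sharp M) [hV : Nonempty G.V] (D : G.V → ℤ) :
    BddAbove {k : ℤ | ∀ F : G.V → ℤ, G.Effective F → G.degD F = k →
      ∃ E : G.V → ℤ, G.Effective E ∧ G.IsPrincipal (D - F - E)} :=
  ⟨_, fun _ hk => le_degD_of_forall hM hV.some hk⟩

/-- A divisor has positive rank iff every vertex lies in the support of an effective divisor
linearly equivalent to it. -/
theorem one_le_rank_iff (hM : Sharp M) [hV : Nonempty G.V] (D : G.V → ℤ) :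
    1 ≤ G.rank D ↔ ∀ v, ∃ E, G.Effective E ∧ G.IsPrincipal (D - Pi.single v 1 - E) := by
  constructor
  · intro h v
    have hne : {k : ℤ | ∀ F : G.V → ℤ, G.Effective F → G.degD F = k →
        ∃ E : G.V → ℤ, G.Effective E ∧ G.IsPrincipal (D - F - E)}.Nonempty := by
      refine ⟨-1, fun F hF hd => ?_⟩
      have : 0 ≤ G.degD F := Finset.sum_nonneg fun u _ => hF u
      omega
    have hmem := Int.csSup_mem hne (bddAbove_rank hM D)
    change ∀ F : G.V → ℤ, G.Effective F → G.degD F = G.rank D → _ at hmem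
    obtain ⟨E, hE, hp⟩ := hmem _ (effective_single v (by omega : 0 ≤ G.rank D)) (degD_single v _)
    refine ⟨E + Pi.single v (G.rank D - 1), fun u => ?_, ?_⟩
    · exact add_nonneg (hE u) (effective_single v (by omega) u)
    · convert hp using 1
      have : (Pi.single v (G.rank D) : G.V → ℤ)
          = Pi.single v 1 + Pi.single v (G.rank D - 1) := by
        rw [← Pi.single_add]
        congr 1
        omega
      rw [this]
      abel
  · intro h
    refine le_csSup (bddAbove_rank hM D) fun F hF hd => ?_
    obtain ⟨v, rfl⟩ := eq_single_of_degD_eq_one hF hd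
    exact h v

theorem degD_pos_of_one_le_rank (hM : Sharp M) [hV : Nonempty G.V] {D : G.V → ℤ}
    (h : 1 ≤ G.rank D) : 1 ≤ G.degD D := by
  obtain ⟨v⟩ := hV
  have h1 := le_degD_of_forall hM v (D := D) (k := 1) fun F hF hd => by
    obtain ⟨v, rfl⟩ := eq_single_of_degD_eq_one hF hd
    have : Nonempty G.V := ⟨v⟩
    exact (one_le_rank_iff hM D).1 h v
  omega

theorem dgon_le (hM : Sharp M) [Nonempty G.V] {D : G.V → ℤ}
    (h : ∀ v, ∃ E, G.Effective E ∧ G.IsPrincipal (D - Pi.single v 1 - E)) :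
    G.dgon ≤ G.degD D := by
  refine csInf_le ⟨1, ?_⟩ ⟨D, (one_le_rank_iff hM D).2 h, rfl⟩
  rintro d ⟨D, hD, rfl⟩
  exact degD_pos_of_one_le_rank hM hD

theorem exists_degD_eq_dgon (hM : Sharp M) [Nonempty G.V] :
    ∃ D : G.V → ℤ, G.degD D = G.dgon ∧
      ∀ v, ∃ E, G.Effective E ∧ G.IsPrincipal (D - Pi.single v 1 - E) := by
  have hne : {d : ℤ | ∃ D : G.V → ℤ, 1 ≤ G.rank D ∧ G.degD D = d}.Nonempty := by
    refine ⟨_, 1, (one_le_rank_iff hM _).2 fun v => ⟨1 - Pi.single v 1, fun u => ?_, ?_⟩, rfl⟩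
    · by_cases h : u = v
      · subst h; simp
      · simp [h]
    · rw [sub_self]
      exact isPrincipal_zero hM
  have hbdd : BddBelow {d : ℤ | ∃ D : G.V → ℤ, 1 ≤ G.rank D ∧ G.degD D = d} := by
    refine ⟨1, ?_⟩
    rintro d ⟨D, hD, rfl⟩
    exact degD_pos_of_one_le_rank hM hD
  obtain ⟨D, hD, hd⟩ := Int.csInf_mem hne hbdd
  exact ⟨D, hd, (one_le_rank_iff hM D).1 hD⟩

end Rank

section Subdivision

theorem sharp_nat : Sharp ℕ := fun a b h => by omega

variable {G : MGraph ℕ}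

/-- The vertex of the subdivision at which a half-edge is rooted. -/
def subRoot (p : SubH G) : SubV G :=
  if h : p.val.2 = 0 then .inl (G.rv p.val.1)
  else .inr (ivtx G p.val.1 p.property.1 p.val.2 (Nat.pos_of_ne_zero h) p.property.2)

/-- The half-edge of the subdivision opposite to a given one. -/
def subOpp (p : SubH G) : SubH G :=
  ⟨(G.i p.val.1, G.l p.val.1 - 1 - p.val.2), isHalfEdge_i p.property.1, by
    have := p.property.2
    show G.l p.val.1 - 1 - p.val.2 < G.l (G.i p.val.1)
    rw [G.l_i]
    omega⟩

instance : Fintype (SubH G) := Fintype.ofFinite _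

instance : Fintype (IntVert G) := Fintype.ofFinite _

theorem SubH.ext_iff {p q : SubH G} : p = q ↔ p.val.1 = q.val.1 ∧ p.val.2 = q.val.2 :=
  Subtype.ext_iff.trans Prod.ext_iff

theorem IntVert.ext_iff {p q : IntVert G} : p = q ↔ p.val.1 = q.val.1 ∧ p.val.2 = q.val.2 :=
  Subtype.ext_iff.trans Prod.ext_iff

/-- The half-edge of the subdivision with the given underlying half-edge and distance. -/
def SubH.mk (x : G.X) (k : ℕ) (hx : G.IsHalfEdge x) (hk : k < G.l x) : SubH G :=
  ⟨(x, k), hx, hk⟩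

/-- The combinatorial Laplacian of an integer-valued function on the subdivision. -/
def subLap (T : SubV G → ℤ) (s : SubV G) : ℤ :=
  ∑ p : SubH G, if subRoot p = s then T s - T (subRoot (subOpp p)) else 0

/-- The vertices of the graph `Subdiv G`. -/
def subdivV : (Subdiv G).V ≃ SubV G where
  toFun x := match x with
    | ⟨.inl s, _⟩ => s
    | ⟨.inr p, h⟩ => absurd h (subI_ne G p)
  invFun s := ⟨.inl s, rfl⟩
  left_inv := by
    rintro ⟨s | p, h⟩
    · rfl
    · exact absurd h (subI_ne G p)
  right_inv _ := rfl

/-- The vertices and half-edges of the graph `Subdiv G`. -/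
def subdivX : (Subdiv G).X ≃ SubV G ⊕ SubH G := Equiv.refl _

theorem subdivV_rv (p : SubH G) : subdivV ((Subdiv G).rv (.inr p)) = subRoot p := by
  rw [← Equiv.eq_symm_apply]
  apply Subtype.ext
  show subR G (.inr p) = .inl (subRoot p)
  simp only [subR, subRoot]
  split_ifs <;> rfl

theorem isPrincipal_subLap (T : SubV G → ℤ) :
    (Subdiv G).IsPrincipal (fun v => subLap T (subdivV v)) := by
  set g : (Subdiv G).V → Gp ℕ := fun v => T (subdivV v) • Gp.of 1 with hg
  have key : ∀ p : SubH G, g ((Subdiv G).rv (.inr p)) - g ((Subdiv G).rv ((Subdiv G).i (.inr p)))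
      = (T (subRoot p) - T (subRoot (subOpp p))) • Gp.of ((Subdiv G).l (.inr p)) := by
    intro p
    have h1 : (Subdiv G).i (.inr p) = .inr (subOpp p) := rfl
    have h2 : (Subdiv G).l (.inr p) = 1 := rfl
    rw [h1, h2, hg]
    simp only [subdivV_rv, sub_smul]
  refine ⟨g, ?_, funext fun v => ?_⟩
  · rintro (s | p) hx
    · exact absurd rfl hx
    · exact ⟨_, key p⟩
  · rw [lap_eq, subLap]
    have h3 : ∀ F : (Subdiv G).X → ℤ, (∑ x, F x)
        = ∑ s : SubV G, F (Sum.inl s : SubV G ⊕ SubH G)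
          + ∑ p : SubH G, F (Sum.inr p : SubV G ⊕ SubH G) := by
      intro F
      rw [← Fintype.sum_sum_type (fun x : SubV G ⊕ SubH G => F x)]
      exact Fintype.sum_equiv subdivX _ _ fun _ => rfl
    rw [h3, Finset.sum_eq_zero, zero_add]
    · refine Finset.sum_congr rfl fun p _ => ?_
      have hp : (Subdiv G).IsHalfEdge (.inr p) := subI_ne G p
      rw [slope_eq sharp_nat hp (key p)]
      simp only [hp, true_and, ← subdivV_rv]
      by_cases h : (Subdiv G).rv (.inr p) = v
      · simp only [h, if_true]
      · rw [if_neg h, if_neg fun h' => h (subdivV.injective h')]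
    · intro s _
      exact if_neg fun h => h.1 rfl

theorem subLap_add (T₁ T₂ : SubV G → ℤ) (s : SubV G) :
    subLap (T₁ + T₂) s = subLap T₁ s + subLap T₂ s := by
  simp only [subLap, ← Finset.sum_add_distrib]
  refine Finset.sum_congr rfl fun p _ => ?_
  split_ifs
  · simp only [Pi.add_apply]; ring
  · simp

/-- The maximum of two functions loses no chips where the first one attains it. -/
theorem subLap_max_le_left (T₁ T₂ : SubV G → ℤ) {c : ℤ} {s : SubV G} (h : T₂ s + c ≤ T₁ s) :
    subLap (fun s => max (T₁ s) (T₂ s + c)) s ≤ subLap T₁ s := by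
  refine Finset.sum_le_sum fun p _ => ?_
  split_ifs
  · have := le_max_left (T₁ (subRoot (subOpp p))) (T₂ (subRoot (subOpp p)) + c)
    simp only [max_eq_left h]
    omega
  · exact le_rfl

theorem subLap_max_le_right (T₁ T₂ : SubV G → ℤ) {c : ℤ} {s : SubV G} (h : T₁ s ≤ T₂ s + c) :
    subLap (fun s => max (T₁ s) (T₂ s + c)) s ≤ subLap T₂ s := by
  refine Finset.sum_le_sum fun p _ => ?_
  split_ifs
  · have := le_max_right (T₁ (subRoot (subOpp p))) (T₂ (subRoot (subOpp p)) + c)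
    simp only [max_eq_right h]
    omega
  · exact le_rfl

/-- The half-edge of the subdivision leaving an interior vertex in the positive direction. -/
def IntVert.fwd (q : IntVert G) : SubH G := ⟨q.val, q.property.1, q.property.2.2.1⟩

/-- The half-edge of the subdivision leaving an interior vertex in the negative direction. -/
def IntVert.bwd (q : IntVert G) : SubH G :=
  ⟨(G.i q.val.1, G.l q.val.1 - q.val.2), isHalfEdge_i q.property.1, by
    have h1 := q.property.2.1
    have h2 := q.property.2.2.1
    show G.l q.val.1 - q.val.2 < G.l (G.i q.val.1)
    rw [G.l_i]
    omega⟩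

theorem ordx_injective : Function.Injective (ordx G) := fun _ _ h =>
  (Fintype.equivFin G.X).injective (Fin.ext h)

theorem ivtx_val_of_le {x : G.X} {hx : G.IsHalfEdge x} {k : ℕ} {hk : 0 < k} {hk' : k < G.l x}
    (h : ordx G x ≤ ordx G (G.i x)) : (ivtx G x hx k hk hk').val = (x, k) := by
  have h1 : ivtx G x hx k hk hk' = ⟨(x, k), hx, hk, hk', h⟩ := dif_pos h
  rw [h1]

theorem ivtx_val_of_not_le {x : G.X} {hx : G.IsHalfEdge x} {k : ℕ} {hk : 0 < k}
    {hk' : k < G.l x} (h : ¬ ordx G x ≤ ordx G (G.i x)) :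
    (ivtx G x hx k hk hk').val = (G.i x, G.l x - k) := by
  exact congrArg Subtype.val (dif_neg h)

theorem subRoot_eq_inl {p : SubH G} {v : G.V} :
    subRoot p = .inl v ↔ p.val.2 = 0 ∧ G.rv p.val.1 = v := by
  unfold subRoot
  split_ifs with h <;> simp [h]

theorem subRoot_eq_inr {p : SubH G} {q : IntVert G} :
    subRoot p = .inr q ↔ p = q.fwd ∨ p = q.bwd := by
  rw [SubH.ext_iff, SubH.ext_iff]
  change _ ↔ p.val.1 = q.val.1 ∧ p.val.2 = q.val.2 ∨
    p.val.1 = G.i q.val.1 ∧ p.val.2 = G.l q.val.1 - q.val.2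
  have hq0 := q.property.2.1
  have hql := q.property.2.2.1
  have hord := q.property.2.2.2
  have hlt : ordx G q.val.1 < ordx G (G.i q.val.1) :=
    lt_of_le_of_ne hord fun h => q.property.1 (ordx_injective h).symm
  have hpl := p.property.2
  unfold subRoot
  split_ifs with hk
  · simp only [false_iff, not_or, not_and]
    exact ⟨fun _ => by omega, fun _ => by omega⟩
  · rw [Sum.inr.injEq, IntVert.ext_iff]
    by_cases ho : ordx G p.val.1 ≤ ordx G (G.i p.val.1)
    · rw [ivtx_val_of_le ho]
      refine ⟨Or.inl, ?_⟩
      rintro (h | ⟨h, -⟩)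
      · exact h
      · rw [h, G.i_invol] at ho
        omega
    · rw [ivtx_val_of_not_le ho]
      constructor
      · rintro ⟨h1, h2⟩
        simp only at h1 h2
        refine Or.inr ⟨by rw [← h1, G.i_invol], ?_⟩
        rw [← h1, G.l_i]
        omega
      · rintro (⟨h, -⟩ | ⟨h1, h2⟩)
        · rw [h] at ho
          exact absurd hord ho
        · refine ⟨by rw [h1, G.i_invol], ?_⟩
          simp only
          rw [h2, h1, G.l_i]
          omega

theorem IntVert.fwd_ne_bwd (q : IntVert G) : q.fwd ≠ q.bwd := by
  intro h
  have h1 := congrArg (fun p : SubH G => p.val.1) h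
  exact q.property.1 h1.symm

theorem subLap_inl (T : SubV G → ℤ) (v : G.V) :
    subLap T (.inl v) = ∑ x : G.X, if h : G.IsHalfEdge x ∧ G.rv x = v then
      T (.inl v) - T (subRoot (subOpp (.mk x 0 h.1 (Nat.pos_of_ne_zero (l_ne_zero h.1)))))
      else 0 := by
  rw [subLap]
  rw [← Finset.sum_filter_add_sum_filter_not (Finset.univ : Finset (SubH G))
    (fun p => p.val.2 = 0)]
  rw [Finset.sum_eq_zero (s := Finset.univ.filter fun p : SubH G => ¬ p.val.2 = 0), add_zero]
  · rw [← Finset.sum_filter_add_sum_filter_not (Finset.univ : Finset G.X) (fun x => G.IsHalfEdge x)]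
    rw [Finset.sum_eq_zero (s := Finset.univ.filter fun x : G.X => ¬ G.IsHalfEdge x), add_zero]
    · refine Finset.sum_bij (fun p _ => p.val.1) ?_ ?_ ?_ ?_
      · intro p _
        simpa using p.property.1
      · rintro p hp p' hp' h
        simp only [Finset.mem_filter, Finset.mem_univ, true_and] at hp hp'
        exact Subtype.ext (Prod.ext h (hp.trans hp'.symm))
      · intro x hx
        simp only [Finset.mem_filter, Finset.mem_univ, true_and] at hx
        exact ⟨.mk x 0 hx (Nat.pos_of_ne_zero (l_ne_zero hx)),
          Finset.mem_filter.2 ⟨Finset.mem_univ _, rfl⟩, rfl⟩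
      · intro p hp
        simp only [Finset.mem_filter, Finset.mem_univ, true_and] at hp
        simp only [subRoot_eq_inl, hp, true_and]
        by_cases h : G.rv p.val.1 = v
        · rw [if_pos h, dif_pos ⟨p.property.1, h⟩]
          congr 4
          exact SubH.ext_iff.2 ⟨rfl, hp⟩
        · rw [if_neg h, dif_neg fun h' => h h'.2]
    · intro x hx
      simp only [Finset.mem_filter, Finset.mem_univ, true_and] at hx
      exact dif_neg fun h => hx h.1
  · intro p hp
    simp only [Finset.mem_filter, Finset.mem_univ, true_and] at hp
    exact if_neg fun h => hp (subRoot_eq_inl.1 h).1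

theorem subLap_inr (T : SubV G → ℤ) (q : IntVert G) :
    subLap T (.inr q) = 2 * T (.inr q) - T (subRoot (subOpp q.fwd))
      - T (subRoot (subOpp q.bwd)) := by
  rw [subLap, ← Finset.sum_filter]
  have : (Finset.univ.filter fun p : SubH G => subRoot p = .inr q) = {q.fwd, q.bwd} := by
    ext p
    simp [subRoot_eq_inr]
  rw [this, Finset.sum_pair q.fwd_ne_bwd]
  ring

/-- The function on the subdivision with prescribed values `a` on old vertices and `f e j` at
distance `j` along `e`. -/
def subFun (a : G.V → ℤ) (f : G.X → ℕ → ℤ) : SubV G → ℤ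
  | .inl v => a v
  | .inr q => f q.val.1 q.val.2

/-- Compatibility of edgewise values with the involution and with the values at vertices. -/
structure Compatible (a : G.V → ℤ) (f : G.X → ℕ → ℤ) : Prop where
  zero : ∀ x, G.IsHalfEdge x → f x 0 = a (G.rv x)
  symm : ∀ x, G.IsHalfEdge x → ∀ j ≤ G.l x, f (G.i x) (G.l x - j) = f x j

variable {a : G.V → ℤ} {f : G.X → ℕ → ℤ}

theorem subFun_subRoot (h : Compatible a f) (p : SubH G) :
    subFun a f (subRoot p) = f p.val.1 p.val.2 := by
  unfold subRoot
  split_ifs with hk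
  · rw [hk]
    exact (h.zero _ p.property.1).symm
  · simp only [subFun]
    by_cases ho : ordx G p.val.1 ≤ ordx G (G.i p.val.1)
    · rw [ivtx_val_of_le ho]
    · rw [ivtx_val_of_not_le ho]
      exact h.symm _ p.property.1 _ p.property.2.le

theorem subFun_subRoot_subOpp (h : Compatible a f) (p : SubH G) :
    subFun a f (subRoot (subOpp p)) = f p.val.1 (p.val.2 + 1) := by
  rw [subFun_subRoot h, ← h.symm _ p.property.1 (p.val.2 + 1) p.property.2]
  simp only [subOpp]
  congr 1
  omega

theorem subFun_fwd (h : Compatible a f) (q : IntVert G) :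
    subFun a f (subRoot (subOpp q.fwd)) = f q.val.1 (q.val.2 + 1) :=
  subFun_subRoot_subOpp h _

theorem subFun_bwd (h : Compatible a f) (q : IntVert G) :
    subFun a f (subRoot (subOpp q.bwd)) = f q.val.1 (q.val.2 - 1) := by
  have h1 := q.property.2.1
  have h2 := q.property.2.2.1
  rw [subFun_subRoot_subOpp h, ← h.symm _ q.property.1 (q.val.2 - 1) (by omega)]
  simp only [IntVert.bwd]
  congr 1
  omega

theorem subLap_subFun_inl (h : Compatible a f) (v : G.V) :
    subLap (subFun a f) (.inl v)
      = ∑ x : G.X, if G.IsHalfEdge x ∧ G.rv x = v then f x 0 - f x 1 else 0 := by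
  rw [subLap_inl]
  refine Finset.sum_congr rfl fun x _ => ?_
  by_cases hx : G.IsHalfEdge x ∧ G.rv x = v
  · have h1 : subFun a f (.inl v) = f x 0 := by
      rw [h.zero x hx.1, hx.2]
      rfl
    rw [dif_pos hx, if_pos hx, subFun_subRoot_subOpp h, h1]
    rfl
  · rw [dif_neg hx, if_neg hx]

theorem subLap_subFun_inr (h : Compatible a f) (q : IntVert G) :
    subLap (subFun a f) (.inr q)
      = 2 * f q.val.1 q.val.2 - f q.val.1 (q.val.2 + 1) - f q.val.1 (q.val.2 - 1) := by
  rw [subLap_inr, subFun_fwd h, subFun_bwd h]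
  rfl

/-- The linear interpolation of an integer-valued function on the vertices. -/
theorem compatible_linear {σ : G.X → ℤ}
    (h : ∀ x, G.IsHalfEdge x → a (G.rv x) - a (G.rv (G.i x)) = σ x * G.l x) :
    Compatible a (fun x k => a (G.rv x) - σ x * k) := by
  refine ⟨fun x _ => by simp, fun x hx j hj => ?_⟩
  have h1 := h x hx
  have h2 := h _ (isHalfEdge_i hx)
  rw [G.i_invol, G.l_i] at h2
  have h3 : σ (G.i x) = -σ x := by
    have h4 : (G.l x : ℤ) ≠ 0 := by exact_mod_cast l_ne_zero hx
    refine mul_right_cancel₀ h4 ?_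
    linarith
  simp only [h3]
  push_cast [hj]
  linarith

/-- Values of the function supported on the edge of `e`, descending with slope one from both
endpoints down to `-m`. -/
def tent (e : G.X) (m : ℕ) (x : G.X) (k : ℕ) : ℤ :=
  if x = e ∨ x = G.i e then -((min (min k (G.l e - k)) m : ℕ) : ℤ) else 0

theorem compatible_tent (e : G.X) (m : ℕ) : Compatible (0 : G.V → ℤ) (tent e m) := by
  refine ⟨fun x _ => by simp [tent], fun x _ j hj => ?_⟩
  have h1 : (G.i x = e ∨ G.i x = G.i e) ↔ (x = e ∨ x = G.i e) := by
    constructor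
    · rintro (h | h)
      · exact Or.inr (by rw [← h, G.i_invol])
      · exact Or.inl (by rw [← G.i_invol x, h, G.i_invol])
    · rintro (h | h)
      · exact Or.inr (by rw [h])
      · exact Or.inl (by rw [h, G.i_invol])
  simp only [tent, h1]
  split_ifs with hx
  · have h2 : G.l x = G.l e := by
      rcases hx with rfl | rfl
      · rfl
      · exact G.l_i e
    rw [h2] at hj ⊢
    congr 2
    omega
  · rfl

theorem subLap_tent_inl_le (e : G.X) (m : ℕ) (v : G.V) :
    subLap (subFun 0 (tent e m)) (.inl v)
      ≤ (if G.rv e = v then 1 else 0) + (if G.rv (G.i e) = v then 1 else 0) := by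
  rw [subLap_subFun_inl (compatible_tent e m)]
  have h1 : ∀ y : G.X, (if G.rv y = v then 1 else 0 : ℤ)
      = ∑ x, if x = y then (if G.rv x = v then 1 else 0) else 0 := fun y => by
    rw [Finset.sum_ite_eq' Finset.univ y, if_pos (Finset.mem_univ y)]
  rw [h1 e, h1 (G.i e), ← Finset.sum_add_distrib]
  refine Finset.sum_le_sum fun x _ => ?_
  have h2 : tent e m x 0 - tent e m x 1 ≤ if x = e ∨ x = G.i e then 1 else 0 := by
    unfold tent
    split_ifs <;> omega
  by_cases h3 : G.rv x = v
  · subst h3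
    simp only [and_true, if_true]
    split_ifs at h2 ⊢ <;> first | omega | tauto
  · simp only [h3, and_false, if_false, ite_self, add_zero, le_refl]

theorem subLap_tent_inr_le (e : G.X) (m : ℕ) (q : IntVert G) :
    subLap (subFun 0 (tent e m)) (.inr q) ≤ 0 := by
  have h1 := q.property.2.1
  have h2 := q.property.2.2.1
  rw [subLap_subFun_inr (compatible_tent e m)]
  unfold tent
  split_ifs with hx
  · have h3 : G.l q.val.1 = G.l e := by
      rcases hx with h | h
      · rw [h]
      · rw [h, G.l_i]
    rw [h3] at h2
    omega
  · simp

theorem subLap_tent_inr_self_le (q : IntVert G) :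
    subLap (subFun 0 (tent q.val.1 (min q.val.2 (G.l q.val.1 - q.val.2)))) (.inr q) ≤ -1 := by
  have h1 := q.property.2.1
  have h2 := q.property.2.2.1
  rw [subLap_subFun_inr (compatible_tent _ _)]
  simp only [tent, true_or, if_true]
  omega

/-- The extension by zero of a divisor to a subdivision. -/
def extendDiv (D : G.V → ℤ) : SubV G → ℤ := Sum.elim D 0

section ExtendLinear

variable {D : G.V → ℤ} {b : G.V → G.V → ℤ} {σ : G.V → G.X → ℤ}

/-- The linear extension to the subdivision of the function `b v`, with slopes `σ v`. -/
def linExt (b : G.V → G.V → ℤ) (σ : G.V → G.X → ℤ) (v : G.V) : SubV G → ℤ :=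
  subFun (b v) (fun x k => b v (G.rv x) - σ v x * k)

theorem single_le_sub_subLap_linExt
    (hb : ∀ v x, G.IsHalfEdge x → b v (G.rv x) - b v (G.rv (G.i x)) = σ v x * G.l x)
    (hE : ∀ v u, (if u = v then 1 else 0)
      ≤ D u - ∑ x, if G.IsHalfEdge x ∧ G.rv x = u then σ v x else 0)
    (v : G.V) (s : SubV G) :
    (if s = .inl v then 1 else 0) ≤ extendDiv D s - subLap (linExt b σ v) s := by
  unfold linExt
  rcases s with u | q
  · rw [subLap_subFun_inl (compatible_linear (hb v))]
    simpa [extendDiv] using hE v u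
  · rw [subLap_subFun_inr (compatible_linear (hb v))]
    have h1 := q.property.2.1
    simp only [extendDiv, Sum.elim_inr, Pi.zero_apply, reduceCtorEq, if_false]
    push_cast [h1]
    linarith

theorem exists_single_le_sub_subLap
    (hb : ∀ v x, G.IsHalfEdge x → b v (G.rv x) - b v (G.rv (G.i x)) = σ v x * G.l x)
    (hloop : ∀ x, G.IsHalfEdge x → G.rv x = G.rv (G.i x) → G.l x = 1)
    (hE : ∀ v u, (if u = v then 1 else 0)
      ≤ D u - ∑ x, if G.IsHalfEdge x ∧ G.rv x = u then σ v x else 0)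
    (s₀ : SubV G) :
    ∃ T : SubV G → ℤ, ∀ s, (if s = s₀ then 1 else 0) ≤ extendDiv D s - subLap T s := by
  rcases s₀ with v | q
  · exact ⟨_, single_le_sub_subLap_linExt hb hE v⟩
  have hlin := single_le_sub_subLap_linExt hb hE
  have hq0 := q.property.2.1
  have hql := q.property.2.2.1
  set e := q.val.1 with he
  set u := G.rv e with hu
  set w := G.rv (G.i e) with hw
  have huw : u ≠ w := fun h => by
    have := hloop e q.property.1 h
    omega
  have hnn : ∀ v s, 0 ≤ extendDiv D s - subLap (linExt b σ v) s := fun v s =>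
    le_trans (by split_ifs <;> simp) (hlin v s)
  set c := linExt b σ u (.inr q) - linExt b σ w (.inr q) with hc
  set T := fun s => max (linExt b σ u s) (linExt b σ w s + c) with hT
  have hTnn : ∀ s, 0 ≤ extendDiv D s - subLap T s := fun s => by
    rcases le_total (linExt b σ w s + c) (linExt b σ u s) with h | h
    · have h1 : subLap T s ≤ subLap (linExt b σ u) s := subLap_max_le_left _ _ h
      have h2 := hnn u s
      omega
    · have h1 : subLap T s ≤ subLap (linExt b σ w) s := subLap_max_le_right _ _ h
      have h2 := hnn w s
      omega
  have hfwd : ∀ v, linExt b σ v (subRoot (subOpp q.fwd)) = linExt b σ v (.inr q) - σ v e := by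
    intro v
    unfold linExt
    rw [subFun_fwd (compatible_linear (hb v))]
    simp only [subFun]
    push_cast
    ring
  have hbwd : ∀ v, linExt b σ v (subRoot (subOpp q.bwd)) = linExt b σ v (.inr q) + σ v e := by
    intro v
    unfold linExt
    rw [subFun_bwd (compatible_linear (hb v))]
    simp only [subFun]
    push_cast [hq0]
    ring
  by_cases hσ : σ u e = σ w e
  · have hinl : ∀ v, linExt b σ v (.inl u) = linExt b σ v (.inr q) + σ v e * q.val.2 := by
      intro v
      simp only [linExt, subFun]
      ring
    have hinl' : ∀ v, linExt b σ v (.inl w)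
        = linExt b σ v (.inr q) + σ v e * q.val.2 - σ v e * G.l e := by
      intro v
      have := hb v e q.property.1
      simp only [linExt, subFun]
      linarith
    have hTu : subLap T (.inl u) ≤ subLap (linExt b σ u) (.inl u) := by
      refine subLap_max_le_left _ _ (le_of_eq ?_)
      rw [hinl, hinl, hσ, hc]
      ring
    have hTw : subLap T (.inl w) ≤ subLap (linExt b σ w) (.inl w) := by
      refine subLap_max_le_right _ _ (le_of_eq ?_)
      rw [hinl', hinl', hσ, hc]
      ring
    have hDu := hlin u (.inl u)
    have hDw := hlin w (.inl w)
    simp only [if_true] at hDu hDw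
    refine ⟨T + subFun 0 (tent e (min q.val.2 (G.l e - q.val.2))), fun s => ?_⟩
    rw [subLap_add]
    have h0 := hTnn s
    rcases s with v | q'
    · have h1 := subLap_tent_inl_le e (min q.val.2 (G.l e - q.val.2)) v
      rw [if_neg (by simp)]
      rw [← hu, ← hw] at h1
      by_cases huv : u = v
      · subst huv
        rw [if_pos rfl, if_neg huw.symm] at h1
        omega
      · rw [if_neg huv] at h1
        by_cases hwv : w = v
        · subst hwv
          rw [if_pos rfl] at h1
          omega
        · rw [if_neg hwv] at h1
          omega
    · split_ifs with h
      · have h1 := subLap_tent_inr_self_le q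
        rw [← he] at h1
        rw [Sum.inr.inj h] at h0 ⊢
        omega
      · have h1 := subLap_tent_inr_le e (min q.val.2 (G.l e - q.val.2)) q'
        omega
  · refine ⟨T, fun s => ?_⟩
    split_ifs with h
    · subst h
      rw [subLap_inr]
      simp only [hT, hfwd, hbwd, extendDiv, Sum.elim_inr, Pi.zero_apply]
      omega
    · exact hTnn s

theorem dgon_subdiv_le [Nonempty G.V]
    (hb : ∀ v x, G.IsHalfEdge x → b v (G.rv x) - b v (G.rv (G.i x)) = σ v x * G.l x)
    (hloop : ∀ x, G.IsHalfEdge x → G.rv x = G.rv (G.i x) → G.l x = 1)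
    (hE : ∀ v u, (if u = v then 1 else 0)
      ≤ D u - ∑ x, if G.IsHalfEdge x ∧ G.rv x = u then σ v x else 0) :
    (Subdiv G).dgon ≤ G.degD D := by
  have hdeg : (Subdiv G).degD (fun v => extendDiv D (subdivV v)) = G.degD D := by
    rw [degD, Fintype.sum_equiv subdivV _ (fun s => extendDiv D s) fun _ => rfl,
      Fintype.sum_sum_type]
    simp [extendDiv, degD]
  have : Nonempty (Subdiv G).V := ⟨subdivV.symm (.inl (Classical.arbitrary G.V))⟩
  rw [← hdeg]
  refine dgon_le sharp_nat fun v => ?_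
  obtain ⟨T, hT⟩ := exists_single_le_sub_subLap hb hloop hE (subdivV v)
  refine ⟨(fun v => extendDiv D (subdivV v)) - Pi.single v 1 - fun v => subLap T (subdivV v),
    fun u => ?_, ?_⟩
  · have h1 := hT (subdivV u)
    simp only [EmbeddingLike.apply_eq_iff_eq] at h1
    simp only [Pi.sub_apply, Pi.single_apply]
    omega
  · rw [sub_sub_cancel]
    exact isPrincipal_subLap T

end ExtendLinear

end Subdivision

section Realize

variable {M}

/-- Finitely many piecewise linear functions can be realised, with the same slopes, by integral
functions for some positive integral edge lengths. -/
theorem exists_integral_realization (hM : Sharp M) (G : MGraph M) {ι : Type*} [Finite ι]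
    (g : ι → G.V → Gp M) (hg : ∀ k, G.IsPL (g k)) :
    ∃ (L : G.X → ℤ) (b : ι → G.V → ℤ), (∀ x, G.IsHalfEdge x → 0 < L x) ∧
      (∀ x, L (G.i x) = L x) ∧ ∀ k x, G.IsHalfEdge x →
        b k (G.rv x) - b k (G.rv (G.i x)) = G.slope (g k) x * L x := by
  obtain ⟨ψ, hψ⟩ := hM.exists_hom_pos (fun x : {x : G.X // G.IsHalfEdge x} => G.l x.val)
    (fun x => l_ne_zero x.property)
  obtain ⟨N, hN, z, hz⟩ := exists_common_den
    (Sum.elim (fun x : G.X => ψ (Gp.of (G.l x))) fun p : ι × G.V => ψ (g p.1 p.2))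
  have hL : ∀ x, (z (.inl x) : ℚ) = N * ψ (Gp.of (G.l x)) := fun x => (hz (.inl x)).symm
  have hb : ∀ k v, (z (.inr (k, v)) : ℚ) = N * ψ (g k v) := fun k v => (hz (.inr (k, v))).symm
  refine ⟨fun x => z (.inl x), fun k v => z (.inr (k, v)), fun x hx => ?_, fun x => ?_,
    fun k x hx => ?_⟩
  · have h1 : (0 : ℚ) < z (.inl x) := by
      rw [hL]
      exact mul_pos (by exact_mod_cast hN) (hψ ⟨x, hx⟩)
    exact_mod_cast h1
  · have h1 : (z (.inl (G.i x)) : ℚ) = z (.inl x) := by rw [hL, hL, G.l_i]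
    exact_mod_cast h1
  · have h1 : (z (.inr (k, G.rv x)) - z (.inr (k, G.rv (G.i x))) : ℚ)
        = G.slope (g k) x * z (.inl x) := by
      rw [hb, hb, hL, ← mul_sub, ← map_sub, slope_spec (hg k) hx, map_zsmul, zsmul_eq_mul]
      ring
    exact_mod_cast h1

theorem slope_eq_zero_of_loop (hM : Sharp M) {G : MGraph M} {g : G.V → Gp M}
    {x : G.X} (hx : G.IsHalfEdge x) (h : G.rv x = G.rv (G.i x)) : G.slope g x = 0 :=
  slope_eq hM hx (by rw [← h]; simp)

end Realize

end MGraph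

/-- **Theorem 4.14.** Let `Γ` be an `M`-metrised graph (`M` a sharp, integral monoid),
and let `G` be the underlying combinatorial graph. Then there is a subdivision `H` of `G`
(namely, `G` with each edge `{e, i e}` subdivided exactly `l₂ e - 1` times for a suitable
assignment `l₂` of positive integers to the edges of `G`), regarded as an `ℕ`-metrised
graph in which every edge has length `1`, such that `dgon(Γ) ≥ dgon(H)`. -/
theorem MGraph.exists_subdivision_dgon_le (M : Type) [AddCancelCommMonoid M]
    (hsharp : Sharp M) (G : MGraph M) (hconn : G.IsConnected) :
    ∃ (l₂ : G.X → ℕ) (h1 : ∀ x, l₂ (G.i x) = l₂ x) (h2 : ∀ x, l₂ x = 0 ↔ G.i x = x),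
      (MGraph.Subdiv (G.reMetrize l₂ h1 h2)).dgon ≤ G.dgon := by
  have hV : Nonempty G.V := hconn.1.map G.rv
  obtain ⟨D, hD, hrank⟩ := MGraph.exists_degD_eq_dgon (G := G) hsharp
  choose E hEff g hgPL hglap using hrank
  obtain ⟨L, b, hLpos, hLi, hb⟩ := MGraph.exists_integral_realization hsharp G g hgPL
  have hvert : ∀ x, G.IsHalfEdge (G.i x) ↔ G.IsHalfEdge x := fun x =>
    ⟨fun h => by simpa [G.i_invol] using MGraph.isHalfEdge_i h, MGraph.isHalfEdge_i⟩
  let l₂ : G.X → ℕ := fun x =>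
    if G.IsHalfEdge x then (if G.rv x = G.rv (G.i x) then 1 else (L x).toNat) else 0
  have h1 : ∀ x, l₂ (G.i x) = l₂ x := fun x => by
    simp only [l₂, hvert, G.i_invol, hLi, eq_comm]
  have h2 : ∀ x, l₂ x = 0 ↔ G.i x = x := fun x => by
    by_cases hx : G.IsHalfEdge x
    · have := hLpos x hx
      refine iff_of_false ?_ hx
      simp only [l₂, if_pos hx]
      by_cases hl : G.rv x = G.rv (G.i x)
      · simp only [if_pos hl]
        exact one_ne_zero
      · simp only [if_neg hl]
        omega
    · exact iff_of_true (if_neg hx) (not_not.1 hx)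
  refine ⟨l₂, h1, h2, ?_⟩
  rw [← hD]
  have hV' : Nonempty (G.reMetrize l₂ h1 h2).V := hV
  refine MGraph.dgon_subdiv_le (G := G.reMetrize l₂ h1 h2) (D := D) (b := b)
    (σ := fun v => G.slope (g v)) ?_ ?_ ?_
  · intro v x hx
    change G.IsHalfEdge x at hx
    change b v (G.rv x) - b v (G.rv (G.i x)) = G.slope (g v) x * (l₂ x : ℤ)
    have hpos := hLpos x hx
    simp only [l₂, if_pos hx]
    split_ifs with hl
    · rw [MGraph.slope_eq_zero_of_loop hsharp hx hl, ← hl]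
      simp
    · rw [hb v x hx, Int.toNat_of_nonneg hpos.le]
  · intro x hx hl
    change G.IsHalfEdge x at hx
    change G.rv x = G.rv (G.i x) at hl
    change l₂ x = 1
    simp only [l₂, if_pos hx, if_pos hl]
  · intro (v : G.V) (u : G.V)
    have hlap := congrFun (hglap v) u
    rw [MGraph.lap_eq] at hlap
    have hE := hEff v u
    change (if u = v then 1 else 0)
      ≤ D u - ∑ x : G.X, if G.IsHalfEdge x ∧ G.rv x = u then G.slope (g v) x else 0
    rw [hlap]
    simp only [Pi.sub_apply, Pi.single_apply]
    omega

end
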